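/- If a k-bialgebra A is generalized-primitively-generated (generated as a k-algebra by its grouplike elements and its generalized primitives), then A is cocommutative, i.e. the comultiplication Δ: A → A ⊗_k A satisfies τ ∘ Δ = Δ, where τ is the flip of the two tensor factors. -/

import Mathlib

/-!
Statement 0: a generalized-primitively-generated bialgebra is cocommutative.
-/

open TensorProduct

section Defs

variable (k A : Type*) [CommSemiring k] [Semiring A] [Bialgebra k A]

/-- An element `Q` of a `k`-bialgebra `A` is *grouplike* if `Δ Q = Q ⊗ Q` and `ε Q = 1`. -/
def IsGrouplike (Q : A) : Prop :=
  Coalgebra.comul (R := k) Q = Q ⊗ₜ[k] Q ∧ Coalgebra.counit (R := k) Q = 1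

/-- For `Q` a grouplike, `a` is a *`Q`-primitive* if `Δ a = a ⊗ Q + Q ⊗ a`. -/
def IsPrimitive (Q a : A) : Prop :=
  Coalgebra.comul (R := k) a = a ⊗ₜ[k] Q + Q ⊗ₜ[k] a

/-- The `k`-submodule of *generalized primitives* of `A`: the span of all `Q`-primitives
for `Q` ranging over the grouplikes of `A`. -/
def genPrim : Submodule k A :=
  Submodule.span k {a : A | ∃ Q : A, IsGrouplike k A Q ∧ IsPrimitive k A Q a}

/-- `A` is *generalized-primitively-generated* if it is generated, as a `k`-algebra, by its
grouplike elements together with its generalized primitives. -/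
def GPGenerated : Prop :=
  Algebra.adjoin k ({a : A | IsGrouplike k A a} ∪ (genPrim k A : Set A)) = ⊤

end Defs

/-- If a `k`-bialgebra `A` is generalized-primitively-generated, then `A` is
cocommutative: the flip of the two tensor factors fixes the image of the comultiplication. -/
theorem gpGenerated_cocommutative (k A : Type*) [Field k] [Semiring A] [Bialgebra k A]
    (hgen : GPGenerated k A) :
    ∀ a : A, (TensorProduct.comm k A A) (Coalgebra.comul (R := k) a) =
      Coalgebra.comul (R := k) a := by
  set flip : A ⊗[k] A →ₐ[k] A ⊗[k] A := (Algebra.TensorProduct.comm k A A).toAlgHom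
  set Δ := Bialgebra.comulAlgHom k A
  have h : flip.comp Δ = Δ := by
    refine AlgHom.ext_of_adjoin_eq_top hgen ?_
    rintro a (ha | ha)
    · simp [flip, Δ, ha.1]
    · refine LinearMap.eqOn_span (f := (flip.comp Δ).toLinearMap) (g := Δ.toLinearMap) ?_ ha
      rintro b ⟨Q, -, hb : Coalgebra.comul (R := k) b = _⟩
      simp [flip, Δ, hb, add_comm]
  exact fun a => DFunLike.congr_fun h a
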